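/- arXiv:1007.3650 — 11 statements merged into one kernel-verified Lean document; each statement's English description precedes it below -/
import Mathlib

section
/- The product of the three PM operators along each row and along each of the first two columns equals the 4×4 identity matrix, the product along the third column equals minus the identity (A·B·C = a·b·c = α·β·γ = A·a·α = B·b·β = 1 and C·c·γ = −1), and consequently A·B·C + a·b·c + α·β·γ + A·a·α + B·b·β − C·c·γ = 6·1, so quantum mechanics predicts the value 6 for the Peres–Mermin operator independently of the state. -/
open Kronecker Matrix

noncomputable section

/-- The 2×2 identity matrix. -/
def σ0 : Matrix (Fin 2) (Fin 2) ℂ := 1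
/-- The Pauli matrix σx. -/
def σx : Matrix (Fin 2) (Fin 2) ℂ := !![0, 1; 1, 0]
/-- The Pauli matrix σy. -/
def σy : Matrix (Fin 2) (Fin 2) ℂ := !![0, -Complex.I; Complex.I, 0]
/-- The Pauli matrix σz. -/
def σz : Matrix (Fin 2) (Fin 2) ℂ := !![1, 0; 0, -1]

/-- The nine Peres-Mermin operators. -/
def PM_A : Matrix (Fin 2 × Fin 2) (Fin 2 × Fin 2) ℂ := σz ⊗ₖ σ0
def PM_B : Matrix (Fin 2 × Fin 2) (Fin 2 × Fin 2) ℂ := σ0 ⊗ₖ σz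
def PM_C : Matrix (Fin 2 × Fin 2) (Fin 2 × Fin 2) ℂ := σz ⊗ₖ σz
def PM_a : Matrix (Fin 2 × Fin 2) (Fin 2 × Fin 2) ℂ := σ0 ⊗ₖ σx
def PM_b : Matrix (Fin 2 × Fin 2) (Fin 2 × Fin 2) ℂ := σx ⊗ₖ σ0
def PM_c : Matrix (Fin 2 × Fin 2) (Fin 2 × Fin 2) ℂ := σx ⊗ₖ σx
def PM_alpha : Matrix (Fin 2 × Fin 2) (Fin 2 × Fin 2) ℂ := σz ⊗ₖ σx
def PM_beta : Matrix (Fin 2 × Fin 2) (Fin 2 × Fin 2) ℂ := σx ⊗ₖ σz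
def PM_gamma : Matrix (Fin 2 × Fin 2) (Fin 2 × Fin 2) ℂ := σy ⊗ₖ σy

theorem σx_mul_self : σx * σx = 1 := by
  simp [σx, Matrix.one_fin_two]

theorem σz_mul_self : σz * σz = 1 := by
  simp [σz, Matrix.one_fin_two]

theorem σz_mul_σx_mul_σy : σz * σx * σy = Complex.I • 1 := by
  simp [σx, σy, σz, Matrix.one_fin_two]

theorem σx_mul_σz_mul_σy : σx * σz * σy = -Complex.I • 1 := by
  simp [σx, σy, σz, Matrix.one_fin_two]

/-- The products of the PM operators along the rows and the first two columns equal
the identity, the product along the third column equals minus the identity, and hence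
the PM operator `χ` equals `6` times the identity: QM predicts the value 6 for every
state. -/
theorem pm_square_quantum_value_six :
    PM_A * PM_B * PM_C = 1 ∧
    PM_a * PM_b * PM_c = 1 ∧
    PM_alpha * PM_beta * PM_gamma = 1 ∧
    PM_A * PM_a * PM_alpha = 1 ∧
    PM_B * PM_b * PM_beta = 1 ∧
    PM_C * PM_c * PM_gamma = -1 ∧
    PM_A * PM_B * PM_C + PM_a * PM_b * PM_c + PM_alpha * PM_beta * PM_gamma +
      PM_A * PM_a * PM_alpha + PM_B * PM_b * PM_beta - PM_C * PM_c * PM_gamma =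
      (6 : ℂ) • (1 : Matrix (Fin 2 × Fin 2) (Fin 2 × Fin 2) ℂ) := by
  have hABC : PM_A * PM_B * PM_C = 1 := by
    simp [PM_A, PM_B, PM_C, σ0, ← mul_kronecker_mul, σz_mul_self]
  have habc : PM_a * PM_b * PM_c = 1 := by
    simp [PM_a, PM_b, PM_c, σ0, ← mul_kronecker_mul, σx_mul_self]
  have hαβγ : PM_alpha * PM_beta * PM_gamma = 1 := by
    simp [PM_alpha, PM_beta, PM_gamma, ← mul_kronecker_mul, σz_mul_σx_mul_σy,
      σx_mul_σz_mul_σy, smul_kronecker, kronecker_smul, smul_smul, -neg_smul]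
  have hAaα : PM_A * PM_a * PM_alpha = 1 := by
    simp [PM_A, PM_a, PM_alpha, σ0, ← mul_kronecker_mul, σz_mul_self, σx_mul_self]
  have hBbβ : PM_B * PM_b * PM_beta = 1 := by
    simp [PM_B, PM_b, PM_beta, σ0, ← mul_kronecker_mul, σz_mul_self, σx_mul_self]
  have hCcγ : PM_C * PM_c * PM_gamma = -1 := by
    simp [PM_C, PM_c, PM_gamma, ← mul_kronecker_mul, σz_mul_σx_mul_σy,
      smul_kronecker, kronecker_smul, smul_smul]
  refine ⟨hABC, habc, hαβγ, hAaα, hBbβ, hCcγ, ?_⟩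
  rw [hABC, habc, hαβγ, hAaα, hBbβ, hCcγ]
  module
end
end

section
/- For every assignment ε of values +1 or −1 to the nine PM observables, the number of contexts K among the six such that the product of ε over the three observables of K differs from the required product of K is odd; in particular it equals 1, 3, or 5. -/
/-- The nine observables of the Peres-Mermin square, indexed by (row, column). -/
abbrev PMObs := Fin 3 × Fin 3

/-- The six contexts of the PM square: `(0, i)` is row `i`, `(1, j)` is column `j`. -/
abbrev PMCtx := Fin 2 × Fin 3

/-- The three observables of a context, enumerated by `Fin 3`. -/
def ctxObs (K : PMCtx) (m : Fin 3) : PMObs :=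
  if K.1 = 0 then (K.2, m) else (m, K.2)

/-- The required product of a context: `-1` for the third column, `+1` otherwise. -/
def pmSign (K : PMCtx) : ℤ := if K = (1, 2) then -1 else 1

/-- Two PM observables are compatible iff they share a row or a column. -/
def Compatible (x y : PMObs) : Prop := x.1 = y.1 ∨ x.2 = y.2

/-- The product of the values that `ε` assigns to the observables of a context. -/
def ctxProd (ε : PMObs → ℤ) (K : PMCtx) : ℤ :=
  ε (ctxObs K 0) * ε (ctxObs K 1) * ε (ctxObs K 2)

/-- Every observable lies in exactly two contexts, so its value enters the product over all
contexts squared. -/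
theorem prod_ctxProd (ε : PMObs → ℤ) : ∏ K, ctxProd ε K = ∏ x, ε x ^ 2 := by
  simp [ctxProd, ctxObs, Fintype.prod_prod_type, Fin.prod_univ_three]
  ring

theorem prod_pmSign : ∏ K, pmSign K = -1 := by
  decide

theorem pmSign_eq_one_or (K : PMCtx) : pmSign K = 1 ∨ pmSign K = -1 := by
  unfold pmSign
  split <;> simp

theorem ctxProd_eq_one_or {ε : PMObs → ℤ} (hε : ∀ x, ε x = 1 ∨ ε x = -1) (K : PMCtx) :
    ctxProd ε K = 1 ∨ ctxProd ε K = -1 := by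
  unfold ctxProd
  rcases hε (ctxObs K 0) with h₀ | h₀ <;> rcases hε (ctxObs K 1) with h₁ | h₁ <;>
    rcases hε (ctxObs K 2) with h₂ | h₂ <;> simp [h₀, h₁, h₂]

/-- For two families of signs, the product of all entries records the parity of the number of
disagreements. -/
theorem neg_one_pow_card_ne {ι : Type*} [Fintype ι] {f g : ι → ℤ}
    (hf : ∀ i, f i = 1 ∨ f i = -1) (hg : ∀ i, g i = 1 ∨ g i = -1) :
    (-1 : ℤ) ^ (Finset.univ.filter fun i => f i ≠ g i).card = (∏ i, f i) * ∏ i, g i := by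
  rw [← Finset.prod_mul_distrib, ← Finset.prod_const, Finset.prod_filter]
  refine Finset.prod_congr rfl fun i _ => ?_
  rcases hf i with h | h <;> rcases hg i with h' | h' <;> simp [h, h']

/-- For every assignment ε of values ±1 to the nine PM observables, the number of
contexts whose product of assigned values differs from the required product is odd;
in particular it equals 1, 3, or 5. -/
theorem pm_odd_number_of_contradictions (ε : PMObs → ℤ)
    (hε : ∀ x, ε x = 1 ∨ ε x = -1) :
    let n := {K : PMCtx |
      ε (ctxObs K 0) * ε (ctxObs K 1) * ε (ctxObs K 2) ≠ pmSign K}.ncard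
    Odd n ∧ (n = 1 ∨ n = 3 ∨ n = 5) := by
  intro n
  have hn : n = (Finset.univ.filter fun K => ctxProd ε K ≠ pmSign K).card := by
    rw [← Set.ncard_coe_finset, Finset.coe_filter_univ]
    rfl
  have hsq : ∏ x, ε x ^ 2 = 1 :=
    Finset.prod_eq_one fun x _ => by rcases hε x with h | h <;> simp [h]
  have hpow : (-1 : ℤ) ^ n = -1 := by
    rw [hn, neg_one_pow_card_ne (ctxProd_eq_one_or hε) pmSign_eq_one_or, prod_ctxProd, hsq,
      prod_pmSign, one_mul]
  have hodd : Odd n := (neg_one_pow_eq_neg_one_iff_odd (by decide)).mp hpow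
  have hle : n ≤ 6 := hn ▸ Finset.card_le_univ _
  refine ⟨hodd, ?_⟩
  obtain ⟨k, hk⟩ := hodd
  omega
end

section
/- Every automaton over the nine PM observables with a designated initial state s₀ such that (i) for every context and every ordering X,Y,Z of its three observables, the input sequence X,Y,Z started in s₀ yields outputs whose product equals the required product of that context (the row/column sequences Q_rc), and (ii) for every observable X, the input sequence X,X started in s₀ yields two equal outputs (the repetition sequences Q_repeat), has at least 3 internal states. -/
/-- A deterministic Mealy automaton with states `S` over observables `Obs`,
outputting values in `{+1, -1}` (as integers). -/
structure Mealy (S : Type) (Obs : Type) where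
  f : S → Obs → ℤ
  δ : S → Obs → S
  sign : ∀ s x, f s x = 1 ∨ f s x = -1

/-- The state reached after processing a list of inputs. -/
def Mealy.run {S Obs : Type} (M : Mealy S Obs) : S → List Obs → S
  | s, [] => s
  | s, x :: xs => M.run (M.δ s x) xs

/-- The output produced at position `i` of input list `L`, started in state `s`. -/
def Mealy.out {S Obs : Type} (M : Mealy S Obs) (s : S) (L : List Obs)
    (i : Fin L.length) : ℤ :=
  M.f (M.run s (L.take i.1)) (L.get i)

/-- The automaton obeys the contextuality sequences Q'_context. -/
def ObeysContext {S : Type} (M : Mealy S PMObs) : Prop :=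
  ∀ (s : S) (K : PMCtx) (L : List PMObs), (∀ x ∈ L, ∃ m, x = ctxObs K m) →
    (∀ i j : Fin L.length, L.get i = L.get j → M.out s L i = M.out s L j) ∧
    (∀ i j k : Fin L.length,
      L.get i = ctxObs K 0 → L.get j = ctxObs K 1 → L.get k = ctxObs K 2 →
      M.out s L i * M.out s L j * M.out s L k = pmSign K)

/-- The automaton obeys the compatibility sequences Q'_compat. -/
def ObeysCompat {S : Type} (M : Mealy S PMObs) : Prop :=
  ∀ (s : S) (Y : PMObs) (L : List PMObs), (∀ x ∈ L, Compatible x Y) →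
    M.f s Y = M.f (M.run (M.δ s Y) L) Y


/-- No assignment of values to the nine observables has all six required products. -/
theorem pmSign_no_value_assignment (v : PMObs → ℤ) :
    ¬ ∀ K : PMCtx, v (ctxObs K 0) * v (ctxObs K 1) * v (ctxObs K 2) = pmSign K := by
  intro h
  have hr := fun i => h (0, i)
  have hc := fun j => h (1, j)
  simp only [ctxObs, pmSign, Prod.mk.injEq, one_ne_zero, zero_ne_one, false_and, true_and,
    if_true, if_false] at hr hc
  have hprod : ∏ i, v (i, 0) * v (i, 1) * v (i, 2) = ∏ j, v (0, j) * v (1, j) * v (2, j) := by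
    simp only [Fin.prod_univ_three]
    ring
  simp only [hr, hc] at hprod
  simp at hprod

/-- If every observable either fixes the initial state or has a state-independent output, then
the outputs of the initial state satisfy every context: measure the former observables first. -/
theorem Mealy.prod_eq_of_forall_perm {S Obs : Type} (M : Mealy S Obs) (s₀ : S)
    (hM : ∀ x, M.δ s₀ x = s₀ ∨ ∀ s, M.f s x = M.f s₀ x) (c : Fin 3 → Obs) (p : ℤ)
    (hc : ∀ π : Equiv.Perm (Fin 3),
      M.f s₀ (c (π 0)) * M.f (M.δ s₀ (c (π 0))) (c (π 1)) *
        M.f (M.δ (M.δ s₀ (c (π 0))) (c (π 1))) (c (π 2)) = p) :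
    M.f s₀ (c 0) * M.f s₀ (c 1) * M.f s₀ (c 2) = p := by
  have h₁ := hc 1
  have h₀₁ := hc (Equiv.swap 0 1)
  have h₀₂ := hc (Equiv.swap 0 2)
  have h₁₂ := hc (Equiv.swap 1 2)
  have e₀₁ : Equiv.swap (0 : Fin 3) 1 2 = 2 := by decide
  have e₀₂ : Equiv.swap (0 : Fin 3) 2 1 = 1 := by decide
  have e₁₂ : Equiv.swap (1 : Fin 3) 2 0 = 0 := by decide
  simp only [Equiv.Perm.one_apply, Equiv.swap_apply_left, Equiv.swap_apply_right,
    e₀₁, e₀₂, e₁₂] at h₁ h₀₁ h₀₂ h₁₂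
  rcases hM (c 0) with a | a <;> rcases hM (c 1) with b | b <;> rcases hM (c 2) with d | d <;>
    simp only [a, b, d] at h₁ h₀₁ h₀₂ h₁₂ <;> linarith

/-- Every automaton with a designated initial state `s₀` that (i) for every context and
every ordering of its three observables yields, on that 3-element input sequence started
in `s₀`, outputs whose product equals the required product of the context (the sequences
Q_rc), and (ii) for every observable `X` yields two equal outputs on the input sequence
`X, X` started in `s₀` (the sequences Q_repeat), has at least 3 internal states. -/
theorem pm_rc_repeat_need_three_states (S : Type) [Fintype S] (M : Mealy S PMObs)
    (s₀ : S)
    (hrc : ∀ (K : PMCtx) (π : Equiv.Perm (Fin 3)),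
      M.f s₀ (ctxObs K (π 0)) *
        M.f (M.δ s₀ (ctxObs K (π 0))) (ctxObs K (π 1)) *
        M.f (M.δ (M.δ s₀ (ctxObs K (π 0))) (ctxObs K (π 1))) (ctxObs K (π 2)) =
      pmSign K)
    (hrep : ∀ X : PMObs, M.f s₀ X = M.f (M.δ s₀ X) X) :
    3 ≤ Fintype.card S := by
  by_contra! hcard
  have hM : ∀ x, M.δ s₀ x = s₀ ∨ ∀ s, M.f s x = M.f s₀ x := by
    intro x
    by_contra! h
    obtain ⟨hδ, s, hs⟩ := h
    have h₁ : s ≠ s₀ := fun e => hs (e ▸ rfl)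
    have h₂ : s ≠ M.δ s₀ x := fun e => hs (e ▸ (hrep x).symm)
    exact hcard.not_ge (Fintype.two_lt_card_iff.2 ⟨s₀, M.δ s₀ x, s, hδ.symm, h₁.symm, h₂.symm⟩)
  exact pmSign_no_value_assignment (M.f s₀) fun K =>
    M.prod_eq_of_forall_perm s₀ hM (ctxObs K) (pmSign K) (hrc K)
end

section
/- The three-state automaton A₃ obeys the contextuality sequences Q'_context of the PM square. -/
/-- Value tables of the automaton `A₃`. -/
def T3 : Fin 3 → Matrix (Fin 3) (Fin 3) ℤ :=
  ![!![1, 1, 1; 1, 1, 1; 1, 1, 1],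
    !![1, 1, 1; -1, 1, -1; -1, -1, 1],
    !![1, -1, -1; 1, 1, 1; -1, -1, 1]]

/-- Transition function of the automaton `A₃`. -/
def δ3 : Fin 3 → PMObs → Fin 3 := fun s x =>
  if s = 0 ∧ x = (0, 2) then 1
  else if s = 0 ∧ x = (1, 2) then 2
  else if s = 1 ∧ x = (0, 1) then 0
  else if s = 1 ∧ x = (2, 1) then 2
  else if s = 2 ∧ x = (1, 0) then 0
  else if s = 2 ∧ x = (2, 0) then 1
  else s

/-- The three-state automaton `A₃`. -/
def A3 : Mealy (Fin 3) PMObs where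
  f s x := T3 s x.1 x.2
  δ := δ3
  sign := by decide


/-- `M` started in `s` is bound to agree on the context `K` with the value table of `t`: that table
has the required product, and it extends the values of `s` that are already determined. -/
def Determines {S : Type} (M : Mealy S PMObs) (K : PMCtx) (s t : S) : Prop :=
  M.f t (ctxObs K 0) * M.f t (ctxObs K 1) * M.f t (ctxObs K 2) = pmSign K ∧
    ∀ m, (M.δ s (ctxObs K m) = s ∨
        M.f s (ctxObs K 0) * M.f s (ctxObs K 1) * M.f s (ctxObs K 2) = pmSign K) →
      M.f t (ctxObs K m) = M.f s (ctxObs K m)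

instance (K : PMCtx) (s t : Fin 3) : Decidable (Determines A3 K s t) := by
  unfold Determines; infer_instance

set_option maxRecDepth 10000 in
lemma A3_exists_determines : ∀ (K : PMCtx) (s : Fin 3), ∃ t, Determines A3 K s t := by
  decide

set_option maxRecDepth 10000 in
lemma A3_determines_of_step : ∀ (K : PMCtx) (s t : Fin 3) (m : Fin 3),
    Determines A3 K (A3.δ s (ctxObs K m)) t →
      Determines A3 K s t ∧ A3.f t (ctxObs K m) = A3.f s (ctxObs K m) := by
  decide

lemma A3_out_eq_table (K : PMCtx) (L : List PMObs) :
    ∀ s : Fin 3, (∀ x ∈ L, ∃ m, x = ctxObs K m) →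
      ∃ t, Determines A3 K s t ∧ ∀ i : Fin L.length, A3.out s L i = A3.f t (L.get i) := by
  induction L with
  | nil =>
    intro s _
    obtain ⟨t, ht⟩ := A3_exists_determines K s
    exact ⟨t, ht, fun i => i.elim0⟩
  | cons x L ih =>
    intro s hL
    obtain ⟨m, rfl⟩ := hL x List.mem_cons_self
    obtain ⟨t, ht, hout⟩ := ih (A3.δ s (ctxObs K m)) fun y hy => hL y (List.mem_cons_of_mem _ hy)
    obtain ⟨hst, hx⟩ := A3_determines_of_step K s t m ht
    exact ⟨t, hst, Fin.cases hx.symm hout⟩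

/-- The three-state automaton `A₃` obeys the contextuality sequences Q'_context
of the PM square. -/
theorem A3_obeys_context : ObeysContext A3 := by
  intro s K L hL
  obtain ⟨t, ⟨hprod, -⟩, hout⟩ := A3_out_eq_table K L s hL
  refine ⟨fun i j h => by rw [hout, hout, h], fun i j k hi hj hk => ?_⟩
  rw [hout, hout, hout, hi, hj, hk, hprod]
end

section
/- The four-state automaton A₄ obeys both the contextuality sequences Q'_context and the compatibility sequences Q'_compat of the PM square. -/
/-- Value tables of the automaton `A₄`. -/
def T4 : Fin 4 → Matrix (Fin 3) (Fin 3) ℤ :=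
  ![!![1, 1, 1; 1, 1, 1; 1, 1, 1],
    !![1, 1, 1; -1, 1, -1; -1, 1, 1],
    !![1, -1, -1; 1, 1, 1; 1, -1, 1],
    !![1, -1, -1; -1, 1, -1; -1, -1, 1]]

/-- Transition function of the automaton `A₄`. -/
def δ4 : Fin 4 → PMObs → Fin 4 := fun s x =>
  if s = 0 ∧ x = (0, 2) then 1
  else if s = 0 ∧ x = (1, 2) then 2
  else if s = 1 ∧ x = (2, 0) then 3
  else if s = 1 ∧ x = (2, 1) then 0
  else if s = 2 ∧ x = (2, 0) then 0
  else if s = 2 ∧ x = (2, 1) then 3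
  else if s = 3 ∧ x = (0, 2) then 2
  else if s = 3 ∧ x = (1, 2) then 1
  else s

/-- The four-state automaton `A₄`. -/
def A4 : Mealy (Fin 4) PMObs where
  f s x := T4 s x.1 x.2
  δ := δ4
  sign := by decide


instance (x y : PMObs) : Decidable (Compatible x y) :=
  inferInstanceAs (Decidable (_ ∨ _))

/-- Observables of a context that are fixed in a state, as well as the one just measured, are
fixed in the next state and keep their values. -/
theorem A4_fixed_step : ∀ (K : PMCtx) (s : Fin 4) (m n : Fin 3),
    (A4.δ s (ctxObs K n) = s ∨ n = m) →
      A4.δ (A4.δ s (ctxObs K m)) (ctxObs K n) = A4.δ s (ctxObs K m) ∧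
      A4.f (A4.δ s (ctxObs K m)) (ctxObs K n) = A4.f s (ctxObs K n) := by
  decide

/-- Every state has a companion state whose table satisfies the constraint of the context and
agrees with the given state on the fixed observables of the context. -/
theorem A4_exists_table : ∀ (K : PMCtx) (s : Fin 4), ∃ t : Fin 4,
    (∀ n, A4.δ s (ctxObs K n) = s → A4.f t (ctxObs K n) = A4.f s (ctxObs K n)) ∧
    A4.f t (ctxObs K 0) * A4.f t (ctxObs K 1) * A4.f t (ctxObs K 2) = pmSign K := by
  decide

/-- The outputs on a sequence from one context are read off from a single table satisfying the
constraint of the context. -/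
theorem A4_exists_table_out (K : PMCtx) (L : List PMObs) (hL : ∀ x ∈ L, ∃ m, x = ctxObs K m) :
    ∀ s : Fin 4, ∃ t : Fin 4,
      (∀ n, A4.δ s (ctxObs K n) = s → A4.f t (ctxObs K n) = A4.f s (ctxObs K n)) ∧
      A4.f t (ctxObs K 0) * A4.f t (ctxObs K 1) * A4.f t (ctxObs K 2) = pmSign K ∧
      ∀ i : Fin L.length, A4.out s L i = A4.f t (L.get i) := by
  induction L with
  | nil =>
    intro s
    obtain ⟨t, h, hprod⟩ := A4_exists_table K s
    exact ⟨t, h, hprod, fun i => i.elim0⟩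
  | cons x L ih =>
    intro s
    obtain ⟨m, rfl⟩ := hL x List.mem_cons_self
    obtain ⟨t, h, hprod, hout⟩ :=
      ih (fun y hy => hL y (List.mem_cons_of_mem _ hy)) (A4.δ s (ctxObs K m))
    have key : ∀ n, (A4.δ s (ctxObs K n) = s ∨ n = m) →
        A4.f t (ctxObs K n) = A4.f s (ctxObs K n) := fun n hn =>
      have hstep := A4_fixed_step K s m n hn
      (h n hstep.1).trans hstep.2
    refine ⟨t, fun n hn => key n (.inl hn), hprod, ?_⟩
    rintro ⟨_ | i, hi⟩
    · exact (key m (.inr rfl)).symm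
    · exact hout ⟨i, Nat.lt_of_succ_lt_succ hi⟩

/-- No single measurement compatible with `Y` changes the value of `Y` in the state `s`. -/
abbrev ValueStable (Y : PMObs) (s : Fin 4) : Prop :=
  ∀ x, Compatible x Y → A4.f (A4.δ s x) Y = A4.f s Y

theorem A4_valueStable_measured : ∀ (Y : PMObs) (s : Fin 4),
    ValueStable Y (A4.δ s Y) ∧ A4.f s Y = A4.f (A4.δ s Y) Y := by
  decide

theorem A4_valueStable_step : ∀ (Y : PMObs) (s : Fin 4), ValueStable Y s →
    ∀ x, Compatible x Y → ValueStable Y (A4.δ s x) := by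
  decide

theorem A4_f_run (Y : PMObs) (L : List PMObs) (hL : ∀ x ∈ L, Compatible x Y) :
    ∀ s, ValueStable Y s → A4.f (A4.run s L) Y = A4.f s Y := by
  induction L with
  | nil => exact fun _ _ => rfl
  | cons x L ih =>
    intro s hs
    have hx := hL x List.mem_cons_self
    exact (ih (fun y hy => hL y (List.mem_cons_of_mem _ hy)) _
      (A4_valueStable_step Y s hs x hx)).trans (hs x hx)

/-- The four-state automaton `A₄` obeys both the contextuality sequences Q'_context
and the compatibility sequences Q'_compat of the PM square. -/
theorem A4_obeys_context_and_compat : ObeysContext A4 ∧ ObeysCompat A4 := by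
  refine ⟨fun s K L hL => ?_, fun s Y L hL => ?_⟩
  · obtain ⟨t, -, hprod, hout⟩ := A4_exists_table_out K L hL s
    refine ⟨fun i j hij => ?_, fun i j k hi hj hk => ?_⟩
    · rw [hout, hout, hij]
    · rw [hout, hout, hout, hi, hj, hk, hprod]
  · obtain ⟨hstable, hval⟩ := A4_valueStable_measured Y s
    exact hval.trans (A4_f_run Y L hL _ hstable).symm
end

section
/- (Condition for fixing the memory.) Let an automaton over the nine PM observables obey the contextuality sequences Q'_context, and suppose some state s assigns to an observable X a value f(s,X) that differs from f(t,X) for every other state t of the automaton. Then δ(s,Y) = s for every observable Y compatible with X (i.e., for every observable in the row or the column of X, including X itself). -/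
/-- Two compatible observables lie in a common context. -/
theorem Compatible.exists_ctx {x y : PMObs} (h : Compatible x y) :
    ∃ K : PMCtx, (∃ m, x = ctxObs K m) ∧ ∃ m, y = ctxObs K m := by
  rcases h with h | h
  · exact ⟨(0, x.1), ⟨x.2, by simp [ctxObs]⟩, ⟨y.2, by simp [ctxObs, h]⟩⟩
  · exact ⟨(1, x.2), ⟨x.1, by simp [ctxObs]⟩, ⟨y.1, by simp [ctxObs, h]⟩⟩

/-- Condition for fixing the memory: if an automaton obeys Q'_context and a state `s`
assigns to an observable `X` a value different from the value assigned by every other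
state, then measuring any observable compatible with `X` (including `X` itself) does not
change the state `s`. -/
theorem pm_fixing_the_memory {S : Type} [Fintype S] (M : Mealy S PMObs)
    (hctx : ObeysContext M) (s : S) (X : PMObs)
    (huniq : ∀ t : S, t ≠ s → M.f t X ≠ M.f s X) :
    ∀ Y : PMObs, Compatible Y X → M.δ s Y = s := by
  intro Y hYX
  have fixed : ∀ t, M.f t X = M.f s X → t = s := fun t ht =>
    by_contra fun hne => huniq t hne ht
  obtain ⟨K, hYK, hXK⟩ := hYX.exists_ctx
  have hX : M.δ s X = s := by
    refine fixed _ ?_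
    have h := (hctx s K [X, X] (by simpa using hXK)).1 ⟨1, by simp⟩ ⟨0, by simp⟩ rfl
    simpa [Mealy.out, Mealy.run] using h
  refine fixed _ ?_
  have h := (hctx s K [X, Y, X] (by simp [hXK, hYK])).1
    ⟨2, by simp⟩ ⟨0, by simp⟩ rfl
  simpa [Mealy.out, Mealy.run, hX] using h
end

section
/- (Contradictions and transformations.) Let an automaton over the nine PM observables obey the contextuality sequences Q'_context, and suppose some context K is contradicted at a state s. Then at most one of the three observables X of K satisfies δ(s,X) = s; i.e., there cannot be two observables of K whose transition at s leaves the state unchanged. -/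
/-- Context `K` is contradicted at state `s`. -/
def Contradicted {S : Type} (M : Mealy S PMObs) (s : S) (K : PMCtx) : Prop :=
  M.f s (ctxObs K 0) * M.f s (ctxObs K 1) * M.f s (ctxObs K 2) ≠ pmSign K

/-- If the first two inputs of a length-three sequence leave the state unchanged, all three outputs
are those of the initial state. -/
theorem Mealy.out_triple_of_fixed {S Obs : Type} (M : Mealy S Obs) {s : S} {x y : Obs} (z : Obs)
    (hx : M.δ s x = s) (hy : M.δ s y = s) (n : Fin [x, y, z].length) :
    M.out s [x, y, z] n = M.f s ([x, y, z].get n) := by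
  change Fin 3 at n
  fin_cases n <;> simp [Mealy.out, Mealy.run, hx, hy]

/-- Contradictions and transformations: if an automaton obeys Q'_context and context `K`
is contradicted at state `s`, then at most one of the three observables of `K` leaves
the state `s` unchanged. -/
theorem pm_contradiction_forces_transformation {S : Type} [Fintype S]
    (M : Mealy S PMObs) (hctx : ObeysContext M) (s : S) (K : PMCtx)
    (hcon : Contradicted M s K) :
    ∀ i j : Fin 3, M.δ s (ctxObs K i) = s → M.δ s (ctxObs K j) = s → i = j := by
  intro i j hi hj
  by_contra hij
  obtain ⟨k, hk⟩ : ∃ k : Fin 3, ∀ m, m = i ∨ m = j ∨ m = k := by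
    clear hi hj
    decide +revert
  let L := [ctxObs K i, ctxObs K j, ctxObs K k]
  have hL : ∀ x ∈ L, ∃ m, x = ctxObs K m := by simp [L]
  have hpos : ∀ m, ∃ n : Fin L.length, L.get n = ctxObs K m := by
    intro m
    apply List.mem_iff_get.mp
    rcases hk m with rfl | rfl | rfl <;> simp [L]
  obtain ⟨a, ha⟩ := hpos 0
  obtain ⟨b, hb⟩ := hpos 1
  obtain ⟨c, hc⟩ := hpos 2
  have hprod := (hctx s K L hL).2 a b c ha hb hc
  have hout : ∀ n : Fin L.length, M.out s L n = M.f s (L.get n) :=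
    M.out_triple_of_fixed _ hi hj
  rw [hout, hout, hout, ha, hb, hc] at hprod
  exact hcon hprod
end

section
/- (Contradictions and other tables.) Let an automaton over the nine PM observables obey the contextuality sequences Q'_context, and suppose some context K is contradicted at a state s. Then (i) there exist two distinct states k ≠ l at which K is not contradicted and whose value tables differ on at least two of the three observables of K, and (ii) there exist two observables X, Y of K with δ(s,X) ≠ δ(s,Y) and δ(s,X) ≠ s and δ(s,Y) ≠ s. -/
section ContextSequences

variable {S : Type} {M : Mealy S PMObs}

/-- A measured value persists under further measurements in the same context. -/
theorem ObeysContext.f_δ (h : ObeysContext M) (s : S) (K : PMCtx) (i : Fin 3) :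
    M.f (M.δ s (ctxObs K i)) (ctxObs K i) = M.f s (ctxObs K i) := by
  have := (h s K [ctxObs K i, ctxObs K i] (by simp)).1 1 0 rfl
  simpa [Mealy.out, Mealy.run] using this

theorem ObeysContext.f_δ_δ (h : ObeysContext M) (s : S) (K : PMCtx) (i j : Fin 3) :
    M.f (M.δ (M.δ s (ctxObs K i)) (ctxObs K j)) (ctxObs K i) = M.f s (ctxObs K i) := by
  have := (h s K [ctxObs K i, ctxObs K j, ctxObs K i] (by simp)).1 2 0 rfl
  simpa [Mealy.out, Mealy.run] using this

theorem ObeysContext.f_δ_δ_δ (h : ObeysContext M) (s : S) (K : PMCtx) (i j k : Fin 3) :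
    M.f (M.δ (M.δ (M.δ s (ctxObs K i)) (ctxObs K j)) (ctxObs K k)) (ctxObs K i) =
      M.f s (ctxObs K i) := by
  have := (h s K [ctxObs K i, ctxObs K j, ctxObs K k, ctxObs K i] (by simp)).1 3 0 rfl
  simpa [Mealy.out, Mealy.run] using this

/-- After two distinct observables of a context are measured, it is not contradicted. -/
theorem ObeysContext.not_contradicted_δ_δ (h : ObeysContext M) (s : S) (K : PMCtx) {i j : Fin 3}
    (hij : i ≠ j) : ¬ Contradicted M (M.δ (M.δ s (ctxObs K i)) (ctxObs K j)) K := by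
  have hi := h.f_δ_δ s K i j
  have hj := h.f_δ (M.δ s (ctxObs K i)) K j
  have key (k : Fin 3) := (h s K [ctxObs K i, ctxObs K j, ctxObs K k] (by simp)).2
  simp only [Contradicted, not_not]
  fin_cases i <;> fin_cases j
  · exact absurd rfl hij
  · have := key 2 0 1 2 rfl rfl rfl
    simp_all [Mealy.out, Mealy.run]
  · have := key 1 0 2 1 rfl rfl rfl
    simp_all [Mealy.out, Mealy.run]
  · have := key 2 1 0 2 rfl rfl rfl
    simp_all [Mealy.out, Mealy.run]
  · exact absurd rfl hij
  · have := key 0 2 0 1 rfl rfl rfl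
    simp_all [Mealy.out, Mealy.run]
  · have := key 1 1 2 0 rfl rfl rfl
    simp_all [Mealy.out, Mealy.run]
  · have := key 0 2 1 0 rfl rfl rfl
    simp_all [Mealy.out, Mealy.run]
  · exact absurd rfl hij

theorem Contradicted.congr {s u : S} {K : PMCtx} (hs : Contradicted M s K)
    (h : ∀ m, M.f u (ctxObs K m) = M.f s (ctxObs K m)) : Contradicted M u K := by
  simpa only [Contradicted, h] using hs

/-- A contradicted and a non-contradicted table that agree on one observable of the context
differ on exactly one of the other two. -/
theorem Contradicted.exists_unique_flip {s u : S} {K : PMCtx} (hs : Contradicted M s K)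
    (hu : ¬ Contradicted M u K) {i : Fin 3} (hi : M.f u (ctxObs K i) = M.f s (ctxObs K i)) :
    ∃ m, m ≠ i ∧ ∀ n, M.f u (ctxObs K n) = M.f s (ctxObs K n) ↔ n ≠ m := by
  simp only [Contradicted, not_not] at hs hu
  rw [← hu] at hs
  clear hu
  simp only [Fin.exists_fin_succ, Fin.forall_fin_succ]
  rcases M.sign s (ctxObs K 0) with h0 | h0 <;> rcases M.sign s (ctxObs K 1) with h1 | h1 <;>
    rcases M.sign s (ctxObs K 2) with h2 | h2 <;>
    rcases M.sign u (ctxObs K 0) with k0 | k0 <;> rcases M.sign u (ctxObs K 1) with k1 | k1 <;>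
    rcases M.sign u (ctxObs K 2) with k2 | k2 <;> fin_cases i <;> simp_all

theorem ObeysContext.not_contradicted_of_δ_eq (h : ObeysContext M) {s : S} {K : PMCtx}
    {i j k : Fin 3} (hij : i ≠ j) (hjk : j ≠ k) (hik : i ≠ k)
    (h₁ : M.δ s (ctxObs K i) = M.δ s (ctxObs K j))
    (h₂ : M.δ s (ctxObs K k) = s ∨ M.δ s (ctxObs K k) = M.δ s (ctxObs K i)) :
    ¬ Contradicted M s K := by
  intro hs
  refine h.not_contradicted_δ_δ s K hij.symm (hs.congr fun m => ?_)
  have hm : m = i ∨ m = j ∨ m = k := by omega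
  rcases hm with rfl | rfl | rfl
  · rw [h.f_δ, ← h₁, h.f_δ]
  · exact h.f_δ_δ s K m i
  · rcases h₂ with h₂ | h₂
    · simpa only [h₂, h₁] using h.f_δ_δ_δ s K m j i
    · rw [← h₁, ← h₂, h.f_δ_δ]

theorem ObeysContext.not_contradicted_of_δ_eq_self (h : ObeysContext M) {s : S} {K : PMCtx}
    {i j : Fin 3} (hij : i ≠ j) (hi : M.δ s (ctxObs K i) = s) (hj : M.δ s (ctxObs K j) = s) :
    ¬ Contradicted M s K := by
  simpa only [hi, hj] using h.not_contradicted_δ_δ s K hij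

end ContextSequences

/-- Contradictions and other tables: if an automaton obeys Q'_context and context `K` is
contradicted at state `s`, then (i) there are two distinct states at which `K` is not
contradicted whose value tables differ on at least two of the three observables of `K`,
and (ii) there are two observables of `K` whose transitions at `s` lead to two different
states, both different from `s`. -/
theorem pm_contradictions_and_other_tables {S : Type} [Fintype S]
    (M : Mealy S PMObs) (hctx : ObeysContext M) (s : S) (K : PMCtx)
    (hcon : Contradicted M s K) :
    (∃ k l : S, k ≠ l ∧ ¬ Contradicted M k K ∧ ¬ Contradicted M l K ∧
      ∃ m m' : Fin 3, m ≠ m' ∧ M.f k (ctxObs K m) ≠ M.f l (ctxObs K m) ∧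
        M.f k (ctxObs K m') ≠ M.f l (ctxObs K m')) ∧
    (∃ i j : Fin 3, M.δ s (ctxObs K i) ≠ M.δ s (ctxObs K j) ∧
      M.δ s (ctxObs K i) ≠ s ∧ M.δ s (ctxObs K j) ≠ s) := by
  constructor
  · have flip (i j : Fin 3) (hij : i ≠ j) : ∃ u, ¬ Contradicted M u K ∧ ∃ m, m ≠ i ∧
        ∀ n, M.f u (ctxObs K n) = M.f s (ctxObs K n) ↔ n ≠ m :=
      ⟨_, hctx.not_contradicted_δ_δ s K hij, hcon.exists_unique_flip
        (hctx.not_contradicted_δ_δ s K hij) (hctx.f_δ_δ s K i j)⟩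
    have differ {u u' : S} {m m' : Fin 3} (hmm : m ≠ m')
        (h : ∀ n, M.f u (ctxObs K n) = M.f s (ctxObs K n) ↔ n ≠ m)
        (h' : ∀ n, M.f u' (ctxObs K n) = M.f s (ctxObs K n) ↔ n ≠ m') :
        u ≠ u' ∧ ∃ m m' : Fin 3, m ≠ m' ∧ M.f u (ctxObs K m) ≠ M.f u' (ctxObs K m) ∧
          M.f u (ctxObs K m') ≠ M.f u' (ctxObs K m') := by
      have hm : M.f u (ctxObs K m) ≠ M.f u' (ctxObs K m) := by
        rw [(h' m).2 hmm]
        exact fun e => (h m).1 e rfl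
      have hm' : M.f u (ctxObs K m') ≠ M.f u' (ctxObs K m') := by
        rw [(h m').2 hmm.symm]
        exact fun e => (h' m').1 e.symm rfl
      exact ⟨fun e => hm (e ▸ rfl), m, m', hmm, hm, hm'⟩
    obtain ⟨u, hu, m, -, h⟩ := flip 0 1 (by decide)
    obtain ⟨u', hu', m', hm', h'⟩ := flip m (m + 1) (by omega)
    obtain ⟨hne, hd⟩ := differ hm'.symm h h'
    exact ⟨u, u', hne, hu, hu', hd⟩
  · have distinct (i j k : Fin 3) (hij : i ≠ j) (hjk : j ≠ k) (hik : i ≠ k)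
        (h₁ : M.δ s (ctxObs K i) = M.δ s (ctxObs K j)) :
        M.δ s (ctxObs K k) ≠ s ∧ M.δ s (ctxObs K k) ≠ M.δ s (ctxObs K i) :=
      not_or.1 fun h₂ => hctx.not_contradicted_of_δ_eq hij hjk hik h₁ h₂ hcon
    have moves (i j : Fin 3) (hij : i ≠ j) (hi : M.δ s (ctxObs K i) = s) :
        M.δ s (ctxObs K j) ≠ s :=
      fun hj => hctx.not_contradicted_of_δ_eq_self hij hi hj hcon
    have d01 := distinct 0 1 2 (by decide) (by decide) (by decide)
    have d02 := distinct 0 2 1 (by decide) (by decide) (by decide)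
    have d12 := distinct 1 2 0 (by decide) (by decide) (by decide)
    have m01 := moves 0 1 (by decide)
    have m02 := moves 0 2 (by decide)
    have m12 := moves 1 2 (by decide)
    by_contra! hcontra
    have c01 := hcontra 0 1
    have c02 := hcontra 0 2
    have c12 := hcontra 1 2
    clear distinct moves hcontra
    grind +splitImp
end

section
/- In any automaton with exactly four internal states over the nine PM observables obeying both the contextuality sequences Q'_context and the compatibility sequences Q'_compat, if there exist two distinct states at which the same context is contradicted (equivalently, the same row or the same column carries a contradiction in two value tables), then at every one of the four states exactly one of the six contexts is contradicted. -/
/-- The laws, written additively, that the values `v` and transitions `δ` of an automaton on the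
square satisfy when it obeys the contextuality and compatibility sequences, for required row
sums `σ` and column sums `τ`. -/
structure Lawful {S : Type} (v : S → Fin 3 → Fin 3 → ZMod 2) (δ : S → Fin 3 → Fin 3 → S)
    (σ τ : Fin 3 → ZMod 2) : Prop where
  odd : ∑ i, σ i + ∑ j, τ j = 1
  rep : ∀ s i j, v (δ s i j) i j = v s i j
  row_compat : ∀ s i j k, v (δ (δ s i j) i k) i j = v s i j
  col_compat : ∀ s i j k, v (δ (δ s i j) k j) i j = v s i j
  row_col_compat : ∀ s i j k l, v (δ (δ (δ s i j) i k) l j) i j = v s i j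
  col_row_compat : ∀ s i j k l, v (δ (δ (δ s i j) k j) i l) i j = v s i j
  row : ∀ s i j k, j ≠ k → ∑ l, v (δ (δ s i j) i k) i l = σ i
  col : ∀ s i j k, i ≠ k → ∑ l, v (δ (δ s i j) k j) l j = τ j

theorem Lawful.transpose {S : Type} {v : S → Fin 3 → Fin 3 → ZMod 2}
    {δ : S → Fin 3 → Fin 3 → S} {σ τ : Fin 3 → ZMod 2} (h : Lawful v δ σ τ) :
    Lawful (fun s i j => v s j i) (fun s i j => δ s j i) τ σ where
  odd := by rw [add_comm, h.odd]
  rep s i j := h.rep s j i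
  row_compat s i j k := h.col_compat s j i k
  col_compat s i j k := h.row_compat s j i k
  row_col_compat s i j k l := h.col_row_compat s j i k l
  col_row_compat s i j k l := h.row_col_compat s j i k l
  row s i j k hjk := h.col s j i k hjk
  col s i j k hik := h.row s j i k hik

theorem ZMod.two_ne_iff {a b : ZMod 2} : a ≠ b ↔ a = b + 1 := by
  revert a b; decide

theorem Fin.sum_eq_of_pairwise_ne {M : Type} [AddCommMonoid M] (g : Fin 3 → M) {x y z : Fin 3}
    (hxy : x ≠ y) (hxz : x ≠ z) (hyz : y ≠ z) : ∑ l, g l = g x + g y + g z := by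
  have huniv : (Finset.univ : Finset (Fin 3)) = {x, y, z} := by
    revert x y z; decide
  rw [huniv, Finset.sum_insert (by simp [hxy, hxz]), Finset.sum_pair hyz, add_assoc]

theorem forall_eq_or_of_card_eq_four {S : Type} [Fintype S] (hcard : Fintype.card S = 4)
    {s t p q : S} (hst : s ≠ t) (hsp : s ≠ p) (hsq : s ≠ q) (htp : t ≠ p) (htq : t ≠ q)
    (hpq : p ≠ q) (u : S) : u = s ∨ u = t ∨ u = p ∨ u = q := by
  classical
  have h : ({s, t, p, q} : Finset S) = Finset.univ := by
    rw [← Finset.card_eq_iff_eq_univ, hcard]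
    simp [*]
  have hu : u ∈ ({s, t, p, q} : Finset S) := by
    rw [h]
    exact Finset.mem_univ u
  simpa using hu

/-- Row `r` is contradicted at `s` and `t` and at no other state; relative to `s`, the values of
row `r` at `p` and `q` are flipped at `z` and at `y` only, respectively. -/
structure SharedRow {S : Type} (v : S → Fin 3 → Fin 3 → ZMod 2) (σ : Fin 3 → ZMod 2)
    (r x y z : Fin 3) (s t p q : S) : Prop where
  hxy : x ≠ y
  hxz : x ≠ z
  hyz : y ≠ z
  all : ∀ u, u = s ∨ u = t ∨ u = p ∨ u = q
  hs : ∑ j, v s r j ≠ σ r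
  ht : ∑ j, v t r j ≠ σ r
  px : v p r x = v s r x
  py : v p r y = v s r y
  pz : v p r z = v s r z + 1
  qx : v q r x = v s r x
  qy : v q r y = v s r y + 1
  qz : v q r z = v s r z

section

variable {S : Type} {v : S → Fin 3 → Fin 3 → ZMod 2} {δ : S → Fin 3 → Fin 3 → S}
    {σ τ : Fin 3 → ZMod 2} {r x y z : Fin 3} {s t p q : S}

theorem SharedRow.swap (c : SharedRow v σ r x y z s t p q) :
    SharedRow v σ r x z y s t q p :=
  ⟨c.hxz, c.hxy, c.hyz.symm, fun u => by have := c.all u; tauto, c.hs, c.ht,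
    c.qx, c.qz, c.qy, c.px, c.pz, c.py⟩

/-- Two measurements in row `r` lead to `p` or `q`. -/
theorem SharedRow.eq_or_eq (c : SharedRow v σ r x y z s t p q) (h : Lawful v δ σ τ)
    (u : S) {j k : Fin 3} (hjk : j ≠ k) :
    δ (δ u r j) r k = p ∨ δ (δ u r j) r k = q := by
  have h1 := h.row u r j k hjk
  have h2 := c.all (δ (δ u r j) r k)
  have := c.hs
  have := c.ht
  grind

theorem SharedRow.values (c : SharedRow v σ r x y z s t p q) (h : Lawful v δ σ τ) :
    v t r y = v s r y ∧ v t r z = v s r z ∨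
      v t r y = v s r y + 1 ∧ v t r z = v s r z + 1 := by
  have h1 := c.eq_or_eq h t c.hxy
  have h2 := h.row_compat t r x y
  have hx : v t r x = v s r x := by
    have := c.px
    have := c.qx
    grind
  have hs := ZMod.two_ne_iff.1 c.hs
  have ht := ZMod.two_ne_iff.1 c.ht
  rw [Fin.sum_eq_of_pairwise_ne _ c.hxy c.hxz c.hyz] at hs ht
  by_cases hy : v t r y = v s r y
  · left
    grind
  · right
    replace hy := ZMod.two_ne_iff.1 hy
    grind

/-- The state reached by measuring row `r` at `y` is determined by the value there. -/
theorem SharedRow.step (c : SharedRow v σ r x y z s t p q) (h : Lawful v δ σ τ) (u : S) :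
    (v u r y = v s r y → δ u r y = p) ∧ (v u r y = v s r y + 1 → δ u r y = q) := by
  have h1 := c.eq_or_eq h u c.hyz
  have h2 := h.row_compat u r y z
  have h3 := h.rep (δ u r y) r z
  have h4 := h.rep u r y
  have h5 := c.all (δ u r y)
  have h6 := c.values h
  have := c.py
  have := c.pz
  have := c.qy
  have := c.qz
  grind

theorem SharedRow.fixed (c : SharedRow v σ r x y z s t p q) (h : Lawful v δ σ τ) (i : Fin 3) :
    δ p i y = p ∧ δ p i z = p := by
  have hy := c.step h
  have hz := c.swap.step h
  have hsy := (hy s).1 rfl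
  have hsz := (hz s).1 rfl
  have hpz := (hz p).2 c.pz
  have py := c.py
  have pz := c.pz
  have qy := c.qy
  have qz := c.qz
  have hmem := c.all (δ p i y)
  have hmem' := c.all (δ p i z)
  have h1 := h.col_compat s r y i
  have h2 := h.col_row_compat s r y i z
  rcases c.values h with ⟨ty, tz⟩ | ⟨ty, tz⟩
  · have hty := (hy t).1 ty
    have htz := (hz t).1 tz
    have h3 := h.col_compat p r z i
    constructor <;> grind
  · have hty := (hy t).2 ty
    have htz := (hz t).2 tz
    have h3 := h.col_compat t r z i
    have h4 := h.col_row_compat t r z i y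
    constructor <;> grind

/-- At `p`, the only contradiction is in column `x`. -/
theorem SharedRow.unique (c : SharedRow v σ r x y z s t p q) (h : Lawful v δ σ τ) :
    (∀ i, ∑ j, v p i j = σ i) ∧ ∀ j, ∑ i, v p i j ≠ τ j ↔ j = x := by
  have hrow (i : Fin 3) : ∑ j, v p i j = σ i := by
    have := h.row p i y z c.hyz
    rwa [(c.fixed h i).1, (c.fixed h i).2] at this
  obtain ⟨i, hi⟩ := exists_ne r
  have hy : ∑ i, v p i y = τ y := by
    have := h.col p r y i hi.symm
    rwa [(c.fixed h r).1, (c.fixed h i).1] at this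
  have hz : ∑ i, v p i z = τ z := by
    have := h.col p r z i hi.symm
    rwa [(c.fixed h r).2, (c.fixed h i).2] at this
  have hx : ∑ i, v p i x ≠ τ x := by
    intro hx
    have hσ : ∑ i, σ i = ∑ j, τ j := by
      simp_rw [← hrow]
      rw [Finset.sum_comm, Fin.sum_eq_of_pairwise_ne _ c.hxy c.hxz c.hyz, hx, hy, hz,
        Fin.sum_eq_of_pairwise_ne _ c.hxy c.hxz c.hyz]
    have := h.odd
    rw [hσ, CharTwo.add_self_eq_zero] at this
    exact zero_ne_one this
  refine ⟨hrow, fun j => ⟨fun hj => ?_, fun hj => hj ▸ hx⟩⟩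
  have huniv : ∀ x y z : Fin 3, x ≠ y → x ≠ z → y ≠ z → ∀ j, j = x ∨ j = y ∨ j = z := by decide
  rcases huniv x y z c.hxy c.hxz c.hyz j with rfl | rfl | rfl
  · rfl
  · exact absurd hy hj
  · exact absurd hz hj

/-- Two states at which the same row is contradicted lead to a `SharedRow` configuration. -/
theorem Lawful.exists_sharedRow [Fintype S] (h : Lawful v δ σ τ) (hcard : Fintype.card S = 4)
    (hst : s ≠ t) (hs : ∑ j, v s r j ≠ σ r) (ht : ∑ j, v t r j ≠ σ r) :
    ∃ p q x y z, SharedRow v σ r x y z s t p q := by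
  have agree (j : Fin 3) : ∃ u, ∑ l, v u r l = σ r ∧ v u r j = v s r j := by
    obtain ⟨k, hk⟩ := exists_ne j
    exact ⟨_, h.row s r j k hk.symm, h.row_compat s r j k⟩
  have differ (u : S) (hu : ∑ l, v u r l = σ r) : ∃ j, v u r j ≠ v s r j := by
    by_contra! hc
    exact hs (by rw [← hu]; exact Finset.sum_congr rfl fun j _ => (hc j).symm)
  obtain ⟨p, hp, -⟩ := agree 0
  obtain ⟨z, hpz⟩ := differ p hp
  obtain ⟨q, hq, hqz⟩ := agree z
  obtain ⟨y, hqy⟩ := differ q hq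
  have hpq : p ≠ q := by rintro rfl; exact hpz hqz
  have all := forall_eq_or_of_card_eq_four hcard hst (by rintro rfl; exact hs hp)
    (by rintro rfl; exact hs hq) (by rintro rfl; exact ht hp) (by rintro rfl; exact ht hq) hpq
  have hyz : y ≠ z := by rintro rfl; exact hqy hqz
  have hpy : v p r y = v s r y := by
    obtain ⟨u, hu, huy⟩ := agree y
    rcases all u with rfl | rfl | rfl | rfl
    · exact absurd hu hs
    · exact absurd hu ht
    · exact huy
    · exact absurd huy hqy
  obtain ⟨x, hxy, hxz⟩ := (by decide : ∀ y z : Fin 3, ∃ x, x ≠ y ∧ x ≠ z) y z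
  rw [ZMod.two_ne_iff] at hpz hqy
  have hs' := ZMod.two_ne_iff.1 hs
  rw [Fin.sum_eq_of_pairwise_ne _ hxy hxz hyz] at hp hq hs'
  exact ⟨p, q, x, y, z, hxy, hxz, hyz, all, hs, ht, by grind, hpy, hpz, by grind, hqy, hqz⟩

/-- If a row is contradicted at two states, then one column is the unique contradiction at both
remaining states. -/
theorem Lawful.exists_unique_col [Fintype S] (h : Lawful v δ σ τ) (hcard : Fintype.card S = 4)
    (hst : s ≠ t) (hs : ∑ j, v s r j ≠ σ r) (ht : ∑ j, v t r j ≠ σ r) :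
    ∃ x, ∀ u, u = s ∨ u = t ∨
      (∀ i, ∑ j, v u i j = σ i) ∧ ∀ j, ∑ i, v u i j ≠ τ j ↔ j = x := by
  obtain ⟨p, q, x, y, z, c⟩ := h.exists_sharedRow hcard hst hs ht
  refine ⟨x, fun u => ?_⟩
  rcases c.all u with rfl | rfl | rfl | rfl
  · exact .inl rfl
  · exact .inr (.inl rfl)
  · exact .inr (.inr (c.unique h))
  · exact .inr (.inr (c.swap.unique h))

end

/-- The sign `1` as `0`, every other integer as `1`. -/
def signBit (a : ℤ) : ZMod 2 := if a = 1 then 0 else 1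

theorem mul_eq_iff_signBit_add {a b c d : ℤ} (ha : a = 1 ∨ a = -1) (hb : b = 1 ∨ b = -1)
    (hc : c = 1 ∨ c = -1) (hd : d = 1 ∨ d = -1) :
    a * b * c = d ↔ signBit a + signBit b + signBit c = signBit d := by
  rcases ha with rfl | rfl <;> rcases hb with rfl | rfl <;> rcases hc with rfl | rfl <;>
    rcases hd with rfl | rfl <;> decide

section

variable {S : Type} {M : Mealy S PMObs}

theorem contradicted_row_iff (s : S) (i : Fin 3) :
    Contradicted M s (0, i) ↔ ∑ j, signBit (M.f s (i, j)) ≠ signBit (pmSign (0, i)) := by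
  rw [Fin.sum_univ_three, Ne, ← mul_eq_iff_signBit_add (M.sign _ _) (M.sign _ _) (M.sign _ _)
    (by revert i; decide)]
  simp [Contradicted, ctxObs]

theorem contradicted_col_iff (s : S) (j : Fin 3) :
    Contradicted M s (1, j) ↔ ∑ i, signBit (M.f s (i, j)) ≠ signBit (pmSign (1, j)) := by
  rw [Fin.sum_univ_three, Ne, ← mul_eq_iff_signBit_add (M.sign _ _) (M.sign _ _) (M.sign _ _)
    (by revert j; decide)]
  simp [Contradicted, ctxObs]

/-- Measuring two observables of a context resolves any contradiction in it. -/
theorem not_contradicted_of_obeys (hctx : ObeysContext M) (hcmp : ObeysCompat M) (s : S)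
    (K : PMCtx) {j k : Fin 3} (hjk : j ≠ k) :
    ¬ Contradicted M (M.δ (M.δ s (ctxObs K j)) (ctxObs K k)) K := by
  have hcomp (a b : Fin 3) : Compatible (ctxObs K a) (ctxObs K b) := by
    unfold Compatible ctxObs
    split <;> simp
  obtain ⟨l, hl⟩ := (by decide : ∀ j k : Fin 3, j ≠ k → ∃ l, ∀ m, m = j ∨ m = k ∨ m = l) j k hjk
  set w := M.δ (M.δ s (ctxObs K j)) (ctxObs K k)
  have key (m : Fin 3) : ∃ n : Fin [ctxObs K j, ctxObs K k, ctxObs K l].length,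
      [ctxObs K j, ctxObs K k, ctxObs K l].get n = ctxObs K m ∧
      M.out s [ctxObs K j, ctxObs K k, ctxObs K l] n = M.f w (ctxObs K m) := by
    rcases hl m with rfl | rfl | rfl
    · exact ⟨⟨0, by simp⟩, rfl, hcmp s _ [ctxObs K k] (by simpa using hcomp k m)⟩
    · exact ⟨⟨1, by simp⟩, rfl, hcmp (M.δ s (ctxObs K j)) _ [] (by simp)⟩
    · exact ⟨⟨2, by simp⟩, rfl, rfl⟩
  obtain ⟨a, ha, ha'⟩ := key 0
  obtain ⟨b, hb, hb'⟩ := key 1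
  obtain ⟨c, hc, hc'⟩ := key 2
  have := (hctx s K _ (by simp)).2 a b c ha hb hc
  rw [ha', hb', hc'] at this
  simpa [Contradicted] using this

theorem lawful_of_obeys (hctx : ObeysContext M) (hcmp : ObeysCompat M) :
    Lawful (fun s i j => signBit (M.f s (i, j))) (fun s i j => M.δ s (i, j))
      (fun i => signBit (pmSign (0, i))) (fun j => signBit (pmSign (1, j))) where
  odd := by decide
  rep s i j := congrArg signBit (hcmp s (i, j) [] (by simp)).symm
  row_compat s i j k := congrArg signBit (hcmp s (i, j) [(i, k)] (by simp [Compatible])).symm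
  col_compat s i j k := congrArg signBit (hcmp s (i, j) [(k, j)] (by simp [Compatible])).symm
  row_col_compat s i j k l :=
    congrArg signBit (hcmp s (i, j) [(i, k), (l, j)] (by simp [Compatible])).symm
  col_row_compat s i j k l :=
    congrArg signBit (hcmp s (i, j) [(k, j), (i, l)] (by simp [Compatible])).symm
  row s i j k hjk :=
    not_not.1 (mt (contradicted_row_iff _ i).2 (not_contradicted_of_obeys hctx hcmp s (0, i) hjk))
  col s i j k hik :=
    not_not.1 (mt (contradicted_col_iff _ j).2 (not_contradicted_of_obeys hctx hcmp s (1, j) hik))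

theorem exists_unique_contradicted [Fintype S] (hcard : Fintype.card S = 4)
    (hctx : ObeysContext M) (hcmp : ObeysCompat M) (K : PMCtx) {s t : S} (hst : s ≠ t)
    (hs : Contradicted M s K) (ht : Contradicted M t K) :
    ∃ K', ∀ u, u = s ∨ u = t ∨ ∀ K'', Contradicted M u K'' ↔ K'' = K' := by
  have h := lawful_of_obeys hctx hcmp
  obtain ⟨b, r⟩ := K
  have hb : b = 0 ∨ b = 1 := (by decide : ∀ b : Fin 2, b = 0 ∨ b = 1) b
  rcases hb with rfl | rfl
  · rw [contradicted_row_iff] at hs ht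
    obtain ⟨x, hx⟩ := h.exists_unique_col hcard hst hs ht
    refine ⟨(1, x), fun u => (hx u).imp_right (.imp_right ?_)⟩
    rintro ⟨hrow, hcol⟩ ⟨b, i⟩
    have hb : b = 0 ∨ b = 1 := (by decide : ∀ b : Fin 2, b = 0 ∨ b = 1) b
    rcases hb with rfl | rfl
    · simp [contradicted_row_iff, hrow]
    · simpa [contradicted_col_iff] using hcol i
  · rw [contradicted_col_iff] at hs ht
    obtain ⟨x, hx⟩ := h.transpose.exists_unique_col hcard hst hs ht
    refine ⟨(0, x), fun u => (hx u).imp_right (.imp_right ?_)⟩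
    rintro ⟨hcol, hrow⟩ ⟨b, i⟩
    have hb : b = 0 ∨ b = 1 := (by decide : ∀ b : Fin 2, b = 0 ∨ b = 1) b
    rcases hb with rfl | rfl
    · simpa [contradicted_row_iff] using hrow i
    · simp [contradicted_col_iff, hcol]

end

/-- In a four-state automaton obeying Q'_context and Q'_compat, if the same context is
contradicted at two distinct states, then at every state exactly one of the six contexts
is contradicted. -/
theorem pm_two_tables_same_contradiction {S : Type} [Fintype S]
    (M : Mealy S PMObs) (hcard : Fintype.card S = 4)
    (hctx : ObeysContext M) (hcmp : ObeysCompat M)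
    (K : PMCtx) (s t : S) (hst : s ≠ t)
    (hs : Contradicted M s K) (ht : Contradicted M t K) :
    ∀ u : S, ∃! K' : PMCtx, Contradicted M u K' := by
  classical
  obtain ⟨K₁, h₁⟩ := exists_unique_contradicted hcard hctx hcmp K hst hs ht
  obtain ⟨p, hp⟩ : ∃ p, p ∉ ({s, t} : Finset S) := by
    by_contra! hc
    have := Finset.card_le_card (fun u _ => hc u : Finset.univ ⊆ ({s, t} : Finset S))
    have := Finset.card_le_two (a := s) (b := t)
    grind [Finset.card_univ]
  obtain ⟨q, hq⟩ : ∃ q, q ∉ ({s, t, p} : Finset S) := by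
    by_contra! hc
    have := Finset.card_le_card (fun u _ => hc u : Finset.univ ⊆ ({s, t, p} : Finset S))
    have := Finset.card_le_three (a := s) (b := t) (c := p)
    grind [Finset.card_univ]
  simp only [Finset.mem_insert, Finset.mem_singleton, not_or] at hp hq
  have hp₁ := ((h₁ p).resolve_left hp.1).resolve_left hp.2
  have hq₁ := ((h₁ q).resolve_left hq.1).resolve_left hq.2.1
  obtain ⟨K₂, h₂⟩ := exists_unique_contradicted hcard hctx hcmp K₁ (Ne.symm hq.2.2)
    ((hp₁ K₁).2 rfl) ((hq₁ K₁).2 rfl)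
  intro u
  rcases h₂ u with rfl | rfl | hu
  · exact ⟨K₁, (hp₁ K₁).2 rfl, fun K' => (hp₁ K').1⟩
  · exact ⟨K₁, (hq₁ K₁).2 rfl, fun K' => (hq₁ K').1⟩
  · exact ⟨K₂, (hu K₂).2 rfl, fun K' => (hu K').1⟩
end

section
/- For each of the 15 contexts of the extended PM square, the product of the three matrices χ_{μν} = σ_μ ⊗ σ_ν belonging to that context equals its required product times the 4×4 identity matrix (the twelve contexts with required product +1 give the identity, the three with required product −1 give minus the identity); consequently the sum over the twelve positive contexts of the products of their three operators minus the sum over the three negative contexts of the products of their three operators equals 15 times the 4×4 identity, so quantum mechanics predicts the value 15 independently of the state. -/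
open Kronecker Matrix

noncomputable section

/-- Index set for the extended PM square: `(μ, ν)` labels `χ_{μν} = σ_μ ⊗ σ_ν`;
the index `(0, 0)` is excluded from the observables. -/
abbrev Idx := Fin 4 × Fin 4

/-- The Pauli matrices `σ₀ = 1, σ₁ = σx, σ₂ = σy, σ₃ = σz`. -/
def pauli : Fin 4 → Matrix (Fin 2) (Fin 2) ℂ :=
  ![1, !![0, 1; 1, 0], !![0, -Complex.I; Complex.I, 0], !![1, 0; 0, -1]]

/-- The operators `χ_{μν} = σ_μ ⊗ σ_ν` of the extended PM square. -/
def χ (p : Idx) : Matrix (Fin 2 × Fin 2) (Fin 2 × Fin 2) ℂ :=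
  pauli p.1 ⊗ₖ pauli p.2

/-- The 15 contexts of the extended PM square, each a trio of commuting observables
together with its required product. -/
def extContexts : List ((Idx × Idx × Idx) × ℤ) :=
  [(((1, 0), (1, 1), (0, 1)), 1), (((1, 0), (1, 2), (0, 2)), 1),
   (((1, 0), (1, 3), (0, 3)), 1), (((2, 0), (2, 1), (0, 1)), 1),
   (((2, 0), (2, 2), (0, 2)), 1), (((2, 0), (2, 3), (0, 3)), 1),
   (((3, 0), (3, 1), (0, 1)), 1), (((3, 0), (3, 2), (0, 2)), 1),
   (((3, 0), (3, 3), (0, 3)), 1),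
   (((1, 1), (2, 3), (3, 2)), 1), (((1, 2), (2, 1), (3, 3)), 1),
   (((1, 3), (2, 2), (3, 1)), 1),
   (((1, 1), (2, 2), (3, 3)), -1), (((1, 2), (2, 3), (3, 1)), -1),
   (((1, 3), (2, 1), (3, 2)), -1)]

theorem pauli_zero : pauli 0 = 1 := rfl

theorem pauli_mul_self (k : Fin 4) : pauli k * pauli k = 1 := by
  fin_cases k <;> simp [pauli, one_fin_two]

theorem pauli_mul_cyclic :
    pauli 1 * pauli 2 = Complex.I • pauli 3 ∧ pauli 2 * pauli 3 = Complex.I • pauli 1 ∧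
      pauli 3 * pauli 1 = Complex.I • pauli 2 := by
  simp [pauli]

theorem pauli_mul_anticyclic :
    pauli 2 * pauli 1 = -Complex.I • pauli 3 ∧ pauli 3 * pauli 2 = -Complex.I • pauli 1 ∧
      pauli 1 * pauli 3 = -Complex.I • pauli 2 := by
  simp [pauli]

theorem χ_mul_χ_mul_χ (p q r : Idx) :
    χ p * χ q * χ r =
      (pauli p.1 * pauli q.1 * pauli r.1) ⊗ₖ (pauli p.2 * pauli q.2 * pauli r.2) := by
  simp only [χ, mul_kronecker_mul]

theorem χ_context_product {c : (Idx × Idx × Idx) × ℤ} (hc : c ∈ extContexts) :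
    χ c.1.1 * χ c.1.2.1 * χ c.1.2.2 =
      (c.2 : ℂ) • (1 : Matrix (Fin 2 × Fin 2) (Fin 2 × Fin 2) ℂ) := by
  rw [χ_mul_χ_mul_χ]
  simp only [extContexts, List.mem_cons, List.not_mem_nil, or_false] at hc
  rcases hc with rfl | rfl | rfl | rfl | rfl | rfl | rfl | rfl | rfl | rfl | rfl | rfl | rfl |
    rfl | rfl <;>
  simp [pauli_zero, pauli_mul_self, pauli_mul_cyclic, pauli_mul_anticyclic, smul_kronecker,
    kronecker_smul, smul_smul, -neg_smul]

theorem χ_context_signed_product {c : (Idx × Idx × Idx) × ℤ} (hc : c ∈ extContexts) :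
    (c.2 : ℂ) • (χ c.1.1 * χ c.1.2.1 * χ c.1.2.2) = 1 := by
  rw [χ_context_product hc, smul_smul]
  have h : c.2 * c.2 = 1 := by
    revert c
    decide
  rw [← Int.cast_mul, h, Int.cast_one, one_smul]

/-- For each of the 15 contexts of the extended PM square, the product of its three
operators equals the required product times the identity; consequently the sum over the
contexts of (required product) × (product of the three operators) equals 15 times the
identity, so QM predicts the value 15 independently of the state. -/
theorem extended_pm_quantum_value_fifteen :
    (∀ c ∈ extContexts, χ c.1.1 * χ c.1.2.1 * χ c.1.2.2 =
      (c.2 : ℂ) • (1 : Matrix (Fin 2 × Fin 2) (Fin 2 × Fin 2) ℂ)) ∧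
    (extContexts.map fun c => (c.2 : ℂ) • (χ c.1.1 * χ c.1.2.1 * χ c.1.2.2)).sum =
      (15 : ℂ) • (1 : Matrix (Fin 2 × Fin 2) (Fin 2 × Fin 2) ℂ) := by
  refine ⟨fun c hc => χ_context_product hc, ?_⟩
  rw [List.map_congr_left fun c hc => χ_context_signed_product hc, List.map_const',
    List.sum_replicate, ← Nat.cast_smul_eq_nsmul ℂ]
  simp [extContexts]
end
end

section
/- For every assignment ε of values +1 or −1 to the 15 observables of the extended PM square, at least 3 of the 15 contexts are violated (i.e., the product of ε over the three observables of the context differs from its required product); equivalently, the sum over the 15 contexts of (required product of the context) times (product of ε over its three observables) is at most 9, while quantum mechanics attains 15. -/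
/-- The product of the values that `ε` assigns to the three observables of a context. -/
def contextValue (ε : Idx → ℤ) (c : (Idx × Idx × Idx) × ℤ) : ℤ :=
  ε c.1.1 * ε c.1.2.1 * ε c.1.2.2

/-- The observables of a context, as a list. -/
def contextPoints (c : (Idx × Idx × Idx) × ℤ) : List Idx :=
  [c.1.1, c.1.2.1, c.1.2.2]

/-- The ten Peres–Mermin squares contained in the extended square, each given by its
six contexts. -/
def merminSquares : List (List ((Idx × Idx × Idx) × ℤ)) :=
  ([[0, 1, 3, 4, 10, 12], [0, 1, 6, 7, 9, 13], [0, 2, 3, 5, 9, 14],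
    [0, 2, 6, 8, 11, 12], [1, 2, 4, 5, 11, 13], [1, 2, 7, 8, 10, 14],
    [3, 4, 6, 7, 11, 14], [3, 5, 6, 8, 10, 13], [4, 5, 7, 8, 9, 12],
    [9, 10, 11, 12, 13, 14]] : List (List (Fin 15))).map
    (List.map fun i => extContexts.get i)

theorem prod_map_contextValue (ε : Idx → ℤ) (L : List ((Idx × Idx × Idx) × ℤ)) :
    (L.map (contextValue ε)).prod = ((L.flatMap contextPoints).map ε).prod := by
  induction L with
  | nil => rfl
  | cons c L ih => simp [contextValue, contextPoints, ih, mul_assoc]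

/-- If the contexts of `L` cover every observable evenly but their required products multiply
to a negative number, then every integer assignment violates one of them. -/
theorem one_le_countP_violated (ε : Idx → ℤ) {L : List ((Idx × Idx × Idx) × ℤ)} {l : List Idx}
    (hneg : (L.map Prod.snd).prod < 0) (hperm : (L.flatMap contextPoints).Perm (l ++ l)) :
    1 ≤ L.countP (fun c => decide (contextValue ε c ≠ c.2)) := by
  rw [Nat.one_le_iff_ne_zero, ne_eq, List.countP_eq_zero]
  intro h
  have heq : L.map (contextValue ε) = L.map Prod.snd :=
    List.map_congr_left fun c hc => by simpa using h c hc
  rw [← heq, prod_map_contextValue, (hperm.map ε).prod_eq, List.map_append,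
    List.prod_append] at hneg
  exact absurd hneg (not_lt.mpr (mul_self_nonneg _))

theorem merminSquares_parity : ∀ L ∈ merminSquares, (L.map Prod.snd).prod < 0 ∧
    (L.flatMap contextPoints).Perm
      ((L.flatMap contextPoints).dedup ++ (L.flatMap contextPoints).dedup) := by
  decide

/-- Every context lies in exactly four of the ten Peres–Mermin squares. -/
theorem merminSquares_flatten_perm :
    merminSquares.flatten.Perm (List.replicate 4 extContexts).flatten := by
  decide

theorem three_le_countP_violated (ε : Idx → ℤ) :
    3 ≤ extContexts.countP (fun c => decide (contextValue ε c ≠ c.2)) := by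
  set p : (Idx × Idx × Idx) × ℤ → Bool := fun c => decide (contextValue ε c ≠ c.2)
  have hcount : (merminSquares.map (List.countP p)).sum = 4 * extContexts.countP p := by
    rw [← List.countP_flatten, merminSquares_flatten_perm.countP_eq, List.countP_flatten]
    simp only [List.map_replicate, List.sum_replicate, smul_eq_mul]
  have hlower : merminSquares.length ≤ (merminSquares.map (List.countP p)).sum := by
    simpa using List.card_nsmul_le_sum (merminSquares.map (List.countP p)) 1 (by
      intro n hn
      obtain ⟨L, hL, rfl⟩ := List.mem_map.mp hn
      obtain ⟨hneg, hperm⟩ := merminSquares_parity L hL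
      exact one_le_countP_violated ε hneg hperm)
  have hlength : merminSquares.length = 10 := rfl
  omega

/-- For signs, the correlation sum is the number of contexts minus twice the number of
violated ones. -/
theorem sum_eq_length_sub_countP {α : Type*} (f g : α → ℤ) (L : List α)
    (hf : ∀ c ∈ L, f c = 1 ∨ f c = -1) (hg : ∀ c ∈ L, g c = 1 ∨ g c = -1) :
    (L.map fun c => g c * f c).sum =
      L.length - 2 * (L.countP (fun c => decide (f c ≠ g c)) : ℤ) := by
  induction L with
  | nil => rfl
  | cons c L ih =>
    simp only [List.forall_mem_cons] at hf hg
    rw [List.map_cons, List.sum_cons, ih hf.2 hg.2, List.countP_cons, List.length_cons]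
    rcases hf.1 with h | h <;> rcases hg.1 with h' | h' <;> simp [h, h'] <;> ring

theorem extContexts_signs_and_points : ∀ c ∈ extContexts, (c.2 = 1 ∨ c.2 = -1) ∧
    c.1.1 ≠ (0, 0) ∧ c.1.2.1 ≠ (0, 0) ∧ c.1.2.2 ≠ (0, 0) := by
  decide

/-- For every assignment ε of values ±1 to the 15 observables of the extended PM square,
at least 3 of the 15 contexts are violated, and the sum over the contexts of
(required product) × (product of the assigned values) is at most 9. -/
theorem extended_pm_noncontextual_bound (ε : Idx → ℤ)
    (hε : ∀ p : Idx, p ≠ (0, 0) → ε p = 1 ∨ ε p = -1) :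
    3 ≤ extContexts.countP
        (fun c => decide (ε c.1.1 * ε c.1.2.1 * ε c.1.2.2 ≠ c.2)) ∧
    (extContexts.map fun c => c.2 * (ε c.1.1 * ε c.1.2.1 * ε c.1.2.2)).sum ≤ 9 := by
  have hcount := three_le_countP_violated ε
  have hsum := sum_eq_length_sub_countP (contextValue ε) Prod.snd extContexts
    (fun c hc => by
      obtain ⟨-, h₁, h₂, h₃⟩ := extContexts_signs_and_points c hc
      rcases hε _ h₁ with h₁ | h₁ <;> rcases hε _ h₂ with h₂ | h₂ <;>
        rcases hε _ h₃ with h₃ | h₃ <;> simp [contextValue, h₁, h₂, h₃])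
    (fun c hc => (extContexts_signs_and_points c hc).1)
  have hlength : extContexts.length = 15 := rfl
  refine ⟨hcount, ?_⟩
  change (extContexts.map fun c => c.2 * contextValue ε c).sum ≤ 9
  rw [hsum]
  omega
end
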